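/- Let X be a real n×k matrix with XᵀX invertible such that the all-ones vector ι lies in the column space of X, let Z be a real n-vector with Z^{⊥X} := (I − P_X)Z ≠ 0, let W = [X Z], and let D be a real n-vector with Dᵀ M⁰ D ≠ 0 and R²_{D∼X} < 1. Then the partial R² of D and Z given X satisfies R²_{D∼Z|X} := (R²_{D∼X+Z} − R²_{D∼X})/(1 − R²_{D∼X}) = R²_{D∼Z^{⊥X}}/(1 − R²_{D∼X}). -/

import Mathlib

open Matrix

/-- Projection matrix onto the column space of `A`: `P_A = A (Aᵀ A)⁻¹ Aᵀ`. -/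
noncomputable def Pmat {n m : ℕ} (A : Matrix (Fin n) (Fin m) ℝ) : Matrix (Fin n) (Fin n) ℝ :=
  A * (Aᵀ * A)⁻¹ * Aᵀ

/-- Projection matrix onto the span of a single column vector `z`, written with
scalar division: `P_z = z zᵀ / (zᵀ z)`. -/
noncomputable def Pvec {n : ℕ} (z : Matrix (Fin n) (Fin 1) ℝ) : Matrix (Fin n) (Fin n) ℝ :=
  ((zᵀ * z) 0 0)⁻¹ • (z * zᵀ)

/-- The deviation-from-means matrix `M⁰ = I - (1/n) ι ιᵀ`. -/
noncomputable def M0 (n : ℕ) : Matrix (Fin n) (Fin n) ℝ :=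
  (1 : Matrix (Fin n) (Fin n) ℝ) - (n : ℝ)⁻¹ • Matrix.of (fun _ _ => (1 : ℝ))

/-- The augmented matrix `W = [X Z]` obtained by appending the column `Z` to `X`. -/
noncomputable def appendCol {n k : ℕ} (X : Matrix (Fin n) (Fin k) ℝ)
    (Z : Matrix (Fin n) (Fin 1) ℝ) : Matrix (Fin n) (Fin (k + 1)) ℝ :=
  Matrix.of fun i => Fin.snoc (X i) (Z i 0)

/-- Total R² of a regression of `Y` on regressors with projection matrix `P`:
`R² = (Yᵀ P M⁰ P Y)/(Yᵀ M⁰ Y)`. -/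
noncomputable def totalR2 {n : ℕ} (Y : Matrix (Fin n) (Fin 1) ℝ)
    (P : Matrix (Fin n) (Fin n) ℝ) : ℝ :=
  (Yᵀ * P * M0 n * P * Y) 0 0 / (Yᵀ * M0 n * Y) 0 0

theorem Pmat_eq_of_leftInv {n m : ℕ} (A : Matrix (Fin n) (Fin m) ℝ) (C : Matrix (Fin m) (Fin n) ℝ)
    (h1 : C * A = 1) (h2 : (A * C)ᵀ = A * C) : Pmat A = A * C := by
  have hinv : (Aᵀ * A)⁻¹ = C * Cᵀ := by
    apply Matrix.inv_eq_left_inv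
    calc C * Cᵀ * (Aᵀ * A) = C * (A * C)ᵀ * A := by
          rw [Matrix.transpose_mul]; simp only [Matrix.mul_assoc]
      _ = (C * A) * (C * A) := by rw [h2]; simp only [Matrix.mul_assoc]
      _ = 1 := by rw [h1, Matrix.one_mul]
  calc Pmat A = A * C * (A * C)ᵀ := by
        rw [Pmat, hinv, Matrix.transpose_mul]; simp only [Matrix.mul_assoc]
    _ = A * (C * A) * C := by rw [h2]; simp only [Matrix.mul_assoc]
    _ = A * C := by rw [h1, Matrix.mul_one]

theorem appendCol_eq {n k : ℕ} (X : Matrix (Fin n) (Fin k) ℝ) (Z : Matrix (Fin n) (Fin 1) ℝ) :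
    appendCol X Z = (fromCols X Z).submatrix id (finSumFinEquiv (m := k) (n := 1)).symm := by
  ext i j
  refine Fin.lastCases ?_ (fun j => ?_) j
  · have : (finSumFinEquiv (m := k) (n := 1)).symm (Fin.last k) = Sum.inr 0 := by
      rw [Equiv.symm_apply_eq]; rfl
    simp [appendCol, this]
  · have : (finSumFinEquiv (m := k) (n := 1)).symm (Fin.castSucc j) = Sum.inl j := by
      rw [Equiv.symm_apply_eq]; rfl
    simp [appendCol, this]

theorem Pmat_symm {n m : ℕ} (X : Matrix (Fin n) (Fin m) ℝ) : (Pmat X)ᵀ = Pmat X := by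
  simp [Pmat, Matrix.transpose_mul, Matrix.transpose_nonsing_inv, Matrix.mul_assoc]

theorem Pmat_mul_self {n k : ℕ} (X : Matrix (Fin n) (Fin k) ℝ) (hX : IsUnit (Xᵀ * X)) :
    Pmat X * X = X := by
  rw [Pmat, Matrix.mul_assoc, Matrix.mul_assoc,
    Matrix.nonsing_inv_mul _ ((Matrix.isUnit_iff_isUnit_det _).1 hX), Matrix.mul_one]

theorem Pmat_append {n k : ℕ} (X : Matrix (Fin n) (Fin k) ℝ)
    (Z z : Matrix (Fin n) (Fin 1) ℝ) (hX : IsUnit (Xᵀ * X))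
    (hz : z = Z - Pmat X * Z) (hzX : zᵀ * X = 0) (hz0 : (zᵀ * z) 0 0 ≠ 0) :
    Pmat (appendCol X Z) = Pmat X + Pvec z := by
  set c := (zᵀ * z) 0 0 with hc
  set r : Matrix (Fin 1) (Fin n) ℝ := c⁻¹ • zᵀ with hr
  have hrX : r * X = 0 := by rw [hr, Matrix.smul_mul, hzX, smul_zero]
  have hzZ : zᵀ * Z = zᵀ * z := by
    have : zᵀ * (Pmat X * Z) = 0 := by
      rw [Pmat]; simp only [← Matrix.mul_assoc]; rw [hzX]; simp
    have h2 : Z = z + Pmat X * Z := by rw [hz]; abel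
    calc zᵀ * Z = zᵀ * (z + Pmat X * Z) := by rw [← h2]
      _ = zᵀ * z := by rw [Matrix.mul_add, this, add_zero]
  have hrZ : r * Z = 1 := by
    rw [hr, Matrix.smul_mul, hzZ]
    ext i j
    fin_cases i; fin_cases j
    simp only [Matrix.smul_apply, smul_eq_mul]
    exact inv_mul_cancel₀ hz0
  have hG : (Xᵀ * X)⁻¹ * Xᵀ * X = 1 := by
    rw [Matrix.mul_assoc, Matrix.nonsing_inv_mul _ ((Matrix.isUnit_iff_isUnit_det _).1 hX)]
  have hzr : z * r = Pvec z := by rw [hr, Matrix.mul_smul, Pvec]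
  set T : Matrix (Fin k) (Fin n) ℝ := (Xᵀ * X)⁻¹ * Xᵀ * (1 - Z * r) with hT
  have hTX : T * X = 1 := by
    rw [hT, Matrix.mul_assoc, Matrix.sub_mul, Matrix.mul_assoc Z, hrX]; simpa using hG
  have hTZ : T * Z = 0 := by
    rw [hT, Matrix.mul_assoc, Matrix.sub_mul, Matrix.mul_assoc Z, hrZ]; simp
  have hWC : X * T + Z * r = Pmat X + Pvec z := by
    have : X * T = Pmat X * (1 - Z * r) := by rw [hT, Pmat]; simp only [Matrix.mul_assoc]
    rw [this, ← hzr, hz, Matrix.mul_sub, Matrix.sub_mul, Matrix.mul_one, Matrix.mul_assoc]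
    abel
  have hmul : appendCol X Z * (fromRows T r).submatrix (finSumFinEquiv (m := k) (n := 1)).symm id
      = Pmat X + Pvec z := by
    rw [appendCol_eq, Matrix.submatrix_mul_equiv, fromCols_mul_fromRows, hWC]; rfl
  rw [← hmul]
  apply Pmat_eq_of_leftInv
  · rw [appendCol_eq, ← Matrix.submatrix_mul _ _ _ _ _ Function.bijective_id,
      fromRows_mul_fromCols, hTX, hTZ, hrX, hrZ, fromBlocks_one, Matrix.submatrix_one_equiv]
  · rw [hmul, Matrix.transpose_add, Pmat_symm]
    simp [Pvec, Matrix.transpose_mul]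

/-- `R²_{D∼Z|X} = R²_{D∼Z^{⊥X}} / (1 − R²_{D∼X})`. -/
theorem partialR2_eq_residR2_div {n k : ℕ} (X : Matrix (Fin n) (Fin k) ℝ)
    (Z D : Matrix (Fin n) (Fin 1) ℝ)
    (hX : IsUnit (Xᵀ * X))
    (hiota : ∃ v : Fin k → ℝ, X *ᵥ v = fun _ => (1 : ℝ))
    (hZperp : Z - Pmat X * Z ≠ 0)
    (hD : (Dᵀ * M0 n * D) 0 0 ≠ 0)
    (hR2 : totalR2 D (Pmat X) < 1) :
    (totalR2 D (Pmat (appendCol X Z)) - totalR2 D (Pmat X)) /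
        (1 - totalR2 D (Pmat X)) =
      totalR2 D (Pvec (Z - Pmat X * Z)) / (1 - totalR2 D (Pmat X)) := by
  congr 1
  set z := Z - Pmat X * Z with hz
  have hXz : Xᵀ * z = 0 := by
    have := congrArg Matrix.transpose (Pmat_mul_self X hX)
    rw [Matrix.transpose_mul, Pmat_symm] at this
    rw [hz, Matrix.mul_sub, ← Matrix.mul_assoc, this, sub_self]
  have hzX : zᵀ * X = 0 := by
    have := congrArg Matrix.transpose hXz
    simpa [Matrix.transpose_mul] using this
  have hz0 : (zᵀ * z) 0 0 ≠ 0 := by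
    intro h
    apply hZperp
    rw [Matrix.mul_apply] at h
    simp only [Matrix.transpose_apply] at h
    rw [Finset.sum_eq_zero_iff_of_nonneg (fun i _ => mul_self_nonneg _)] at h
    ext i j
    fin_cases j
    simpa using h i (Finset.mem_univ _)
  have hPz : Pmat X * z = 0 := by rw [Pmat, Matrix.mul_assoc, hXz, Matrix.mul_zero]
  have hzP : zᵀ * Pmat X = 0 := by
    have := congrArg Matrix.transpose hPz
    simpa [Matrix.transpose_mul, Pmat_symm] using this
  obtain ⟨v, hv⟩ := hiota
  have hJz : (Matrix.of (fun _ _ => (1 : ℝ)) : Matrix (Fin n) (Fin n) ℝ) * z = 0 := by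
    have hJ : (Matrix.of (fun _ _ => (1 : ℝ)) : Matrix (Fin n) (Fin n) ℝ)
        = (Matrix.of (fun _ j => v j) : Matrix (Fin n) (Fin k) ℝ) * Xᵀ := by
      ext i j
      have := congrFun hv j
      simp only [Matrix.mulVec, dotProduct] at this
      simp only [Matrix.mul_apply, Matrix.of_apply, Matrix.transpose_apply]
      rw [← this]
      exact Finset.sum_congr rfl fun _ _ => mul_comm _ _
    rw [hJ, Matrix.mul_assoc, hXz, Matrix.mul_zero]
  have hMz : M0 n * z = z := by
    rw [M0, Matrix.sub_mul, Matrix.smul_mul, hJz]; simp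
  have hMt : (M0 n)ᵀ = M0 n := by
    rw [M0, Matrix.transpose_sub, Matrix.transpose_smul, Matrix.transpose_one]; rfl
  have hzM : zᵀ * M0 n = zᵀ := by
    have := congrArg Matrix.transpose hMz
    rwa [Matrix.transpose_mul, hMt] at this
  have h1 : Pmat X * M0 n * Pvec z = 0 := by
    rw [Pvec, Matrix.mul_smul, Matrix.mul_assoc, ← Matrix.mul_assoc (M0 n), hMz,
      ← Matrix.mul_assoc, hPz]; simp
  have h2 : Pvec z * M0 n * Pmat X = 0 := by
    rw [Pvec, Matrix.smul_mul, Matrix.smul_mul, Matrix.mul_assoc z, hzM, Matrix.mul_assoc, hzP]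
    simp
  have key : (Pmat X + Pvec z) * M0 n * (Pmat X + Pvec z)
      = Pmat X * M0 n * Pmat X + Pvec z * M0 n * Pvec z := by
    rw [Matrix.add_mul, Matrix.add_mul, Matrix.mul_add, Matrix.mul_add, h1, h2]; simp
  have hform : ∀ P : Matrix (Fin n) (Fin n) ℝ,
      totalR2 D P = (Dᵀ * (P * M0 n * P) * D) 0 0 / (Dᵀ * M0 n * D) 0 0 := by
    intro P; rw [totalR2]; simp only [Matrix.mul_assoc]
  rw [Pmat_append X Z z hX hz hzX hz0, hform, hform, hform, key, Matrix.mul_add, Matrix.add_mul,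
    Matrix.add_apply]
  ring
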